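/- Let k be an algebraically closed field, O = k[[t]], and let (V, F•, θ) be a local parabolic triple: V is a free O-module of rank r with filtration V = V⁰ ⊃ V¹ ⊃ ⋯ ⊃ V^σ = t·V, the fiber dimensions dim_k(V^{i−1}/V^{i}) rearranged decreasingly give a partition n₁ ≥ ⋯ ≥ n_σ of r with conjugate partition μ₁ ≥ ⋯ ≥ μ_{n₁}; θ ∈ End_O(V) satisfies θ(V^i) ⊆ V^{i+1} for 0 ≤ i ≤ σ−1; and the characteristic polynomial of θ factors as f = ∏_{i=1}^{n₁} f_i in O[λ] with each f_i Eisenstein of degree μ_i, such that for i ≠ j the difference of the constant terms of f_i and f_j is not in t²·k[[t]]. Then V decomposes as the internal direct sum V = ⨁_{i=1}^{n₁} Ker f_i(θ). Consequently V is a free module of rank 1 over the product ring Ã = ∏_{i=1}^{n₁} O[λ]/(f_i), where λ acts on V as θ. -/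

import Mathlib

open Pointwise
namespace PLD
open Polynomial

section Length
variable {R : Type*} [CommRing R] {M : Type*} [AddCommGroup M] [Module R M]

lemma length_quot_chain {A B : Submodule R M} (h : B ≤ A) :
    Module.length R (M ⧸ B) = Module.length R (↥A ⧸ B.comap A.subtype) + Module.length R (M ⧸ A) := by
  apply Module.length_eq_add_of_exact
    ((B.comap A.subtype).mapQ B A.subtype le_rfl) (B.mapQ A LinearMap.id h)
  · rw [← LinearMap.ker_eq_bot, Submodule.ker_mapQ]
    simp
  · rw [← LinearMap.range_eq_top, Submodule.range_mapQ]
    simp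
  · rw [LinearMap.exact_iff, Submodule.ker_mapQ, Submodule.range_mapQ]
    simp

lemma length_quot_range_mul (φ ψ : Module.End R M) (hφ : Function.Injective φ) :
    Module.length R (M ⧸ LinearMap.range (φ * ψ)) =
      Module.length R (M ⧸ LinearMap.range ψ) + Module.length R (M ⧸ LinearMap.range φ) := by
  have h1 : LinearMap.range ψ ≤ (LinearMap.range (φ * ψ)).comap φ := by
    rintro _ ⟨x, rfl⟩
    exact ⟨x, rfl⟩
  have h2 : LinearMap.range (φ * ψ) ≤ (LinearMap.range φ).comap LinearMap.id := by
    rintro _ ⟨x, rfl⟩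
    exact ⟨ψ x, rfl⟩
  apply Module.length_eq_add_of_exact
    (Submodule.mapQ _ _ φ h1) (Submodule.mapQ _ _ LinearMap.id h2)
  · rw [← LinearMap.ker_eq_bot, Submodule.ker_mapQ, eq_bot_iff]
    rintro _ ⟨x, ⟨y, hy⟩, rfl⟩
    have : ψ y = x := hφ hy
    simp only [Submodule.mem_bot]
    exact (Submodule.Quotient.mk_eq_zero _).2 ⟨y, this⟩
  · rw [← LinearMap.range_eq_top, Submodule.range_mapQ]
    simp
  · rw [LinearMap.exact_iff, Submodule.ker_mapQ, Submodule.range_mapQ]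
    simp

lemma length_quot_range_pow (φ : Module.End R M) (hφ : Function.Injective φ) (n : ℕ) :
    Module.length R (M ⧸ LinearMap.range (φ ^ n)) =
      n * Module.length R (M ⧸ LinearMap.range φ) := by
  induction n with
  | zero =>
    simp only [pow_zero, Nat.cast_zero, zero_mul, Module.length_eq_zero_iff]
    exact Submodule.Quotient.subsingleton_iff.2 (LinearMap.range_eq_top.2 fun x => ⟨x, rfl⟩)
  | succ n ih =>
    rw [pow_succ', length_quot_range_mul _ _ hφ, ih]
    push_cast
    ring

lemma length_split {V : Type*} [AddCommGroup V] [Module R V] (P Q A B : Submodule R V)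
    (hdis : ∀ x ∈ P, x ∈ Q → x = 0)
    (hA : ∀ x ∈ A, ∃ y ∈ P, ∃ z ∈ Q, y ∈ A ∧ z ∈ A ∧ x = y + z)
    (hB : ∀ x ∈ B, ∃ y ∈ P, ∃ z ∈ Q, y ∈ B ∧ z ∈ B ∧ x = y + z) :
    Module.length R (↥A ⧸ B.comap A.subtype) =
      Module.length R (↥(A.comap P.subtype) ⧸
        (B.comap P.subtype).comap (A.comap P.subtype).subtype) +
      Module.length R (↥(A.comap Q.subtype) ⧸
        (B.comap Q.subtype).comap (A.comap Q.subtype).subtype) := by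
  let iP : ↥(A.comap P.subtype) →ₗ[R] A :=
    (P.subtype ∘ₗ (A.comap P.subtype).subtype).codRestrict A (fun x => x.2)
  let iQ : ↥(A.comap Q.subtype) →ₗ[R] A :=
    (Q.subtype ∘ₗ (A.comap Q.subtype).subtype).codRestrict A (fun x => x.2)
  let φ : (↥(A.comap P.subtype) × ↥(A.comap Q.subtype)) →ₗ[R] (↥A ⧸ B.comap A.subtype) :=
    (B.comap A.subtype).mkQ ∘ₗ (iP.coprod iQ)
  let ψ : (↥(A.comap P.subtype) × ↥(A.comap Q.subtype)) →ₗ[R] _ :=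
    LinearMap.prodMap ((B.comap P.subtype).comap (A.comap P.subtype).subtype).mkQ
      ((B.comap Q.subtype).comap (A.comap Q.subtype).subtype).mkQ
  have hφ : Function.Surjective φ := by
    intro x
    obtain ⟨⟨x, hx⟩, rfl⟩ := Submodule.mkQ_surjective _ x
    obtain ⟨y, hy, z, hz, hyA, hzA, rfl⟩ := hA x hx
    exact ⟨(⟨⟨y, hy⟩, hyA⟩, ⟨⟨z, hz⟩, hzA⟩), rfl⟩
  have hψ : Function.Surjective ψ :=
    Function.Surjective.prodMap (Submodule.mkQ_surjective _) (Submodule.mkQ_surjective _)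
  have hker : LinearMap.ker φ = LinearMap.ker ψ := by
    ext ⟨⟨⟨a, ha⟩, ha'⟩, ⟨⟨b, hb⟩, hb'⟩⟩
    have e1 : (((⟨⟨a, ha⟩, ha'⟩, ⟨⟨b, hb⟩, hb'⟩) :
        (↥(A.comap P.subtype) × ↥(A.comap Q.subtype))) ∈ LinearMap.ker φ) ↔ a + b ∈ B := by
      rw [LinearMap.mem_ker]
      exact Submodule.Quotient.mk_eq_zero _
    have e2 : (((⟨⟨a, ha⟩, ha'⟩, ⟨⟨b, hb⟩, hb'⟩) :
        (↥(A.comap P.subtype) × ↥(A.comap Q.subtype))) ∈ LinearMap.ker ψ) ↔ a ∈ B ∧ b ∈ B := by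
      rw [LinearMap.mem_ker]
      refine Prod.mk_eq_zero.trans (and_congr ?_ ?_)
      · exact Submodule.Quotient.mk_eq_zero _
      · exact Submodule.Quotient.mk_eq_zero _
    rw [e1, e2]
    constructor
    · intro h
      obtain ⟨y, hy, z, hz, hyB, hzB, hyz⟩ := hB _ h
      have : a - y = 0 := hdis _ (P.sub_mem ha hy) (by
        have : a - y = z - b := by rw [sub_eq_sub_iff_add_eq_add, hyz, add_comm]
        rw [this]; exact Q.sub_mem hz hb)
      obtain rfl : a = y := sub_eq_zero.1 this
      obtain rfl : b = z := add_left_cancel hyz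
      exact ⟨hyB, hzB⟩
    · rintro ⟨h1, h2⟩
      exact B.add_mem h1 h2
  rw [← Module.length_prod, ← (φ.quotKerEquivOfSurjective hφ).length_eq,
    ← (ψ.quotKerEquivOfSurjective hψ).length_eq, hker]

lemma length_chain (σ : ℕ) (W : ℕ → Submodule R M) (hW0 : W 0 = ⊤)
    (hle : ∀ i < σ, W (i + 1) ≤ W i) :
    Module.length R (M ⧸ W σ) =
      ∑ i ∈ Finset.range σ, Module.length R (↥(W i) ⧸ (W (i+1)).comap (W i).subtype) := by
  induction σ with
  | zero =>
    simp only [Finset.range_zero, Finset.sum_empty, Module.length_eq_zero_iff]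
    exact Submodule.Quotient.subsingleton_iff.2 hW0
  | succ n ih =>
    rw [Finset.sum_range_succ, ← ih fun i hi => hle i (by omega),
      length_quot_chain (hle n (by omega)), add_comm]

lemma length_gr_eq_zero_iff (A B : Submodule R M) :
    Module.length R (↥A ⧸ B.comap A.subtype) = 0 ↔ A ≤ B := by
  rw [Module.length_eq_zero_iff, Submodule.Quotient.subsingleton_iff,
    Submodule.comap_subtype_eq_top]

end Length

section Filt
variable {R : Type*} [CommRing R] {M : Type*} [AddCommGroup M] [Module R M]

open Classical in
lemma filt_pow (σ : ℕ) (W : ℕ → Submodule R M) (θ : Module.End R M)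
    (hle : ∀ i < σ, W (i + 1) ≤ W i)
    (hθ : ∀ i < σ, ∀ x ∈ W i, θ x ∈ W (i + 1)) (a b : ℕ) (hab : a ≤ b) (hb : b ≤ σ) :
    ∀ x ∈ W a, (θ ^ ((Finset.Ico a b).filter (fun j => ¬ W j ≤ W (j+1))).card) x ∈ W b := by
  induction b, hab using Nat.le_induction with
  | base => intro x hx; simpa using hx
  | succ b hab ih =>
    intro x hx
    have := ih (by omega) x hx
    rw [← Finset.insert_Ico_right_eq_Ico_add_one hab, Finset.filter_insert]
    split_ifs with h
    · exact h this
    · rw [Finset.card_insert_of_notMem (by simp), pow_succ']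
      exact hθ b (by omega) _ this

open Classical in
lemma filt_pow_smul (t : R) (σ : ℕ) (W : ℕ → Submodule R M) (θ : Module.End R M)
    (hW0 : W 0 = ⊤) (hWσ : ∀ x ∈ W σ, ∃ y, x = t • y)
    (hle : ∀ i < σ, W (i + 1) ≤ W i)
    (hθ : ∀ i < σ, ∀ x ∈ W i, θ x ∈ W (i + 1)) (a : ℕ) (ha : a ≤ σ) :
    ∀ x ∈ W a, ∃ y ∈ W a,
      (θ ^ ((Finset.range σ).filter (fun j => ¬ W j ≤ W (j+1))).card) x = t • y := by
  intro x hx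
  obtain ⟨y, hy⟩ := hWσ _ (filt_pow σ W θ hle hθ a σ ha le_rfl x hx)
  have h2 := filt_pow σ W θ hle hθ 0 a (by omega) ha y (by rw [hW0]; trivial)
  refine ⟨_, h2, ?_⟩
  rw [← map_smul, ← hy, ← Module.End.mul_apply, ← pow_add]
  congr 2
  rw [Finset.range_eq_Ico, ← Finset.Ico_union_Ico_eq_Ico (Nat.zero_le a) ha,
    Finset.filter_union, Finset.card_union_of_disjoint]
  exact Finset.disjoint_filter_filter (Finset.Ico_disjoint_Ico_consecutive _ _ _)
end Filt

section Basic
variable {R : Type*} [CommRing R] {M : Type*} [AddCommGroup M] [Module R M]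

lemma aeval_comm_apply (θ : Module.End R M) (p q : R[X]) (x : M) :
    aeval θ p (aeval θ q x) = aeval θ q (aeval θ p x) := by
  rw [← Module.End.mul_apply, ← Module.End.mul_apply, ← map_mul, ← map_mul, mul_comm]

lemma aeval_mul_apply (θ : Module.End R M) (p q : R[X]) (x : M) :
    aeval θ (p * q) x = aeval θ p (aeval θ q x) := by
  rw [← Module.End.mul_apply, ← map_mul]

lemma aeval_C_apply (θ : Module.End R M) (c : R) (x : M) :
    aeval θ (C c) x = c • x := by
  simp

lemma aeval_mem (θ : Module.End R M) (P : Submodule R M) (hP : ∀ x ∈ P, θ x ∈ P) (p : R[X]) :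
    ∀ x ∈ P, aeval θ p x ∈ P := by
  induction p using Polynomial.induction_on' with
  | add p q hp hq =>
    intro x hx
    rw [map_add]
    exact P.add_mem (hp x hx) (hq x hx)
  | monomial n a =>
    intro x hx
    rw [← C_mul_X_pow_eq_monomial, aeval_mul_apply, aeval_C_apply]
    refine P.smul_mem _ ?_
    rw [aeval_X_pow]
    induction n with
    | zero => simpa using hx
    | succ n ih => rw [pow_succ']; exact hP _ ih

lemma aeval_restrict (θ : Module.End R M) (P : Submodule R M) (hP : ∀ x ∈ P, θ x ∈ P) (p : R[X])
    (x : P) : ((aeval (θ.restrict hP) p x : P) : M) = aeval θ p (x : M) := by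
  induction p using Polynomial.induction_on' generalizing x with
  | add p q hp hq => simp [hp, hq]
  | monomial n a =>
    rw [← C_mul_X_pow_eq_monomial, aeval_mul_apply, aeval_C_apply, aeval_mul_apply, aeval_C_apply,
      aeval_X_pow, aeval_X_pow]
    rw [Submodule.coe_smul]
    congr 1
    induction n generalizing x with
    | zero => simp
    | succ n ih => rw [pow_succ, pow_succ]; exact ih _

lemma aeval_bijective [Module.Finite R M] [IsLocalRing R] (t : R) (ht : ¬ IsUnit t)
    (θ : Module.End R M) (N : ℕ) (hN : ∀ x, ∃ y, (θ ^ N) x = t • y)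
    (u : R[X]) (hu : IsUnit (u.coeff 0)) : Function.Bijective (aeval θ u) := by
  have hcop : IsCoprime u (X ^ N) := by
    apply IsCoprime.pow_right
    obtain ⟨c, hc⟩ := hu.exists_left_inv
    refine ⟨C c, - (C c * u.divX), ?_⟩
    have h := u.divX_mul_X_add
    calc _ = C c * (u - u.divX * X) := by ring
      _ = C c * C (u.coeff 0) := by congr 1; nth_rewrite 1 [← h]; ring
      _ = 1 := by rw [← C_mul, hc, C_1]
  obtain ⟨a, b, hab⟩ := hcop
  have hsurj : Function.Surjective (aeval θ u) := by
    rw [← LinearMap.range_eq_top, ← top_le_iff]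
    refine Submodule.le_of_le_smul_of_le_jacobson_bot (I := Ideal.span {t}) Module.Finite.fg_top ?_ ?_
    · rw [IsLocalRing.jacobson_eq_maximalIdeal ⊥ bot_ne_top, Ideal.span_singleton_le_iff_mem]
      exact ht
    · intro x _
      have h : x = aeval θ u (aeval θ a x) + (θ ^ N) (aeval θ b x) := by
        rw [aeval_comm_apply θ u a, ← aeval_mul_apply, ← aeval_X_pow (R := R) θ, aeval_comm_apply θ _ b,
          ← aeval_mul_apply, ← LinearMap.add_apply, ← map_add, hab, map_one, Module.End.one_apply]
      rw [h]
      refine Submodule.add_mem_sup ⟨_, rfl⟩ ?_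
      obtain ⟨y, hy⟩ := hN (aeval θ b x)
      rw [hy]
      exact Submodule.smul_mem_smul (Ideal.mem_span_singleton_self t) trivial
  exact ⟨OrzechProperty.injective_of_surjective_endomorphism _ hsurj, hsurj⟩

/-- Splitting lemma. `f₁ = X^d + t w₁`, and, for `j ∈ S`, `f₁ - X^(e j) f j = t u j` with `u j`
having unit constant coefficient. -/
lemma splitting [Module.Finite R M] [IsLocalRing R] (t : R) (ht : ¬ IsUnit t)
    (htor : ∀ x : M, t • x = 0 → x = 0)
    (θ : Module.End R M) (N : ℕ) (hN : ∀ x, ∃ y, (θ ^ N) x = t • y)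
    (f₁ w₁ : R[X]) (hf₁ : f₁ = X ^ N + C t * w₁)
    (S : Finset ℕ) (f u : ℕ → R[X]) (e : ℕ → ℕ)
    (hf : ∀ j ∈ S, f₁ - X ^ (e j) * f j = C t * u j)
    (hu : ∀ j ∈ S, IsUnit ((u j).coeff 0))
    (hann : aeval θ (f₁ * ∏ j ∈ S, f j) = 0) (x : M) :
    ∃ y z, x = y + z ∧ aeval θ f₁ y = 0 ∧ aeval θ (∏ j ∈ S, f j) z = 0 := by
  classical
  have htpow : ∀ (n : ℕ) (x : M), t ^ n • x = 0 → x = 0 := by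
    intro n
    induction n with
    | zero => intro x hx; simpa using hx
    | succ n ih => intro x hx; rw [pow_succ, mul_smul] at hx; exact htor _ (ih _ hx)
  have hdiv : ∀ z : M, ∃ y, aeval θ f₁ z = t • y := by
    intro z
    obtain ⟨y, hy⟩ := hN z
    refine ⟨y + aeval θ w₁ z, ?_⟩
    rw [hf₁, map_add, LinearMap.add_apply, aeval_X_pow, hy, aeval_mul_apply, aeval_C_apply, smul_add]
  have key : ∀ T ⊆ S, ∀ w : M, ∃ z x' y : M, t • y = aeval θ f₁ x' ∧
      t ^ T.card • z = aeval θ (X ^ (∑ j ∈ T, e j) * ∏ j ∈ T, f j) w ∧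
      z = aeval θ (∏ j ∈ T, - u j) w + y := by
    intro T
    induction T using Finset.induction_on with
    | empty => intro _ w; exact ⟨w, 0, 0, by simp, by simp, by simp⟩
    | insert j T hj ih =>
      intro hT w
      obtain ⟨z, x', y, h1, h2, h3⟩ := ih (fun a ha => hT (Finset.mem_insert_of_mem ha)) w
      obtain ⟨y0, hy0⟩ := hdiv z
      have hjS := hf j (hT (Finset.mem_insert_self j T))
      have hz : t • (y0 - aeval θ (u j) z) = aeval θ (X ^ (e j) * f j) z := by
        have : X ^ (e j) * f j = f₁ - C t * u j := by rw [← hjS]; ring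
        rw [smul_sub, ← hy0, this, map_sub, LinearMap.sub_apply, aeval_mul_apply, aeval_C_apply]
      refine ⟨y0 - aeval θ (u j) z, z - aeval θ (u j) x', y0 - aeval θ (u j) y, ?_, ?_, ?_⟩
      · rw [smul_sub, map_sub, ← hy0, aeval_comm_apply, ← h1, map_smul]
      · rw [Finset.card_insert_of_notMem hj, pow_succ, mul_smul, hz, ← map_smul, h2,
          ← aeval_mul_apply, Finset.sum_insert hj, Finset.prod_insert hj, pow_add]
        congr 2
        ring
      · rw [Finset.prod_insert hj, aeval_mul_apply, h3]
        simp only [map_neg, LinearMap.neg_apply, map_add]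
        abel
  have hU : IsUnit ((∏ j ∈ S, - u j).coeff 0) := by
    rw [Polynomial.coeff_zero_prod]
    rw [IsUnit.prod_iff]
    intro j hj
    rw [coeff_neg]
    exact (hu j hj).neg
  obtain ⟨w, hw⟩ := (aeval_bijective t ht θ N hN _ hU).2 x
  obtain ⟨z, x', y, h1, h2, h3⟩ := key S subset_rfl w
  refine ⟨z, - y, ?_, ?_, ?_⟩
  · rw [h3, hw]; abel
  · apply htpow S.card
    rw [← map_smul, h2, ← aeval_mul_apply]
    have : f₁ * (X ^ (∑ j ∈ S, e j) * ∏ j ∈ S, f j) =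
      X ^ (∑ j ∈ S, e j) * (f₁ * ∏ j ∈ S, f j) := by ring
    rw [this, map_mul, hann, mul_zero, LinearMap.zero_apply]
  · apply htor
    rw [← map_smul, smul_neg, h1, map_neg, ← aeval_mul_apply, mul_comm, hann]
    simp

lemma splitting_disjoint [Module.Finite R M] [IsLocalRing R] (t : R) (ht : ¬ IsUnit t)
    (htor : ∀ x : M, t • x = 0 → x = 0)
    (θ : Module.End R M) (N : ℕ) (hN : ∀ x, ∃ y, (θ ^ N) x = t • y)
    (f₁ : R[X])
    (S : Finset ℕ) (f u : ℕ → R[X]) (e : ℕ → ℕ)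
    (hf : ∀ j ∈ S, f₁ - X ^ (e j) * f j = C t * u j)
    (hu : ∀ j ∈ S, IsUnit ((u j).coeff 0)) (x : M) (hx : aeval θ f₁ x = 0)
    (hx' : aeval θ (∏ j ∈ S, f j) x = 0) : x = 0 := by
  classical
  induction S using Finset.induction_on with
  | empty => simpa using hx'
  | insert j T hj ih =>
    refine ih (fun a ha => hf a (Finset.mem_insert_of_mem ha))
      (fun a ha => hu a (Finset.mem_insert_of_mem ha)) ?_
    rw [Finset.prod_insert hj, aeval_mul_apply] at hx'
    set y := aeval θ (∏ j ∈ T, f j) x with hy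
    have h1 : aeval θ f₁ y = 0 := by rw [hy, aeval_comm_apply, hx, map_zero]
    have h2 : t • aeval θ (u j) y = 0 := by
      rw [← aeval_C_apply θ, ← aeval_mul_apply, ← hf j (Finset.mem_insert_self j T), map_sub,
        LinearMap.sub_apply, h1, aeval_mul_apply, hx', map_zero, sub_zero]
    exact (aeval_bijective t ht θ N hN _ (hu j (Finset.mem_insert_self j T))).1
      ((htor _ h2).trans (map_zero _).symm)

end Basic

section DVR
variable {R : Type*} [CommRing R] [IsDomain R] [IsDiscreteValuationRing R]

lemma length_quot_smul {M : Type*} [AddCommGroup M] [Module R M] [Module.Free R M]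
    [Module.Finite R M] (t : R) (ht : Irreducible t) :
    Module.length R (M ⧸ LinearMap.range (t • (1 : Module.End R M))) = Module.finrank R M := by
  have hmax : (Ideal.span {t}).IsMaximal := by
    rw [← ht.maximalIdeal_eq]; infer_instance
  have hs : IsSimpleModule R (R ⧸ Ideal.span {t}) :=
    isSimpleModule_iff_isCoatom.2 hmax.out
  let b := Module.finBasis R M
  let φ : M →ₗ[R] (Fin (Module.finrank R M) → R ⧸ Ideal.span {t}) :=
    (LinearMap.pi fun i => (Submodule.mkQ (Ideal.span {t})) ∘ₗ LinearMap.proj i) ∘ₗ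
      b.equivFun.toLinearMap
  have hφ : ∀ x i, φ x i = Ideal.Quotient.mk (Ideal.span {t}) (b.equivFun x i) := fun x i => rfl
  have hsurj : Function.Surjective φ := by
    intro y
    choose z hz using fun i => Ideal.Quotient.mk_surjective (y i)
    refine ⟨b.equivFun.symm z, ?_⟩
    ext i
    rw [hφ, LinearEquiv.apply_symm_apply, hz]
  have hker : LinearMap.ker φ = LinearMap.range (t • (1 : Module.End R M)) := by
    ext x
    rw [LinearMap.mem_ker]
    constructor
    · intro h
      have : ∀ i, ∃ c, b.equivFun x i = t * c := by
        intro i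
        have := congrFun h i
        rw [hφ] at this
        exact Ideal.mem_span_singleton.1 (Ideal.Quotient.eq_zero_iff_mem.1 this)
      choose c hc using this
      refine ⟨b.equivFun.symm c, ?_⟩
      apply b.equivFun.injective
      ext i
      simp only [LinearMap.smul_apply, Module.End.one_apply, map_smul,
        LinearEquiv.apply_symm_apply, Pi.smul_apply, smul_eq_mul, hc]
    · rintro ⟨y, rfl⟩
      ext i
      rw [hφ]
      simp only [LinearMap.smul_apply, Module.End.one_apply, map_smul, Pi.smul_apply, smul_eq_mul,
        Pi.zero_apply]
      exact Ideal.Quotient.eq_zero_iff_mem.2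
        (Ideal.mul_mem_right _ _ (Ideal.mem_span_singleton_self t))
  rw [← hker, (φ.quotKerEquivOfSurjective hsurj).length_eq, Module.length_pi]
  rw [Module.length_eq_one]
  simp

section
variable {M : Type*} [AddCommGroup M] [Module R M] [Module.Free R M] [Module.Finite R M]

lemma smul_tor (t : R) (ht : Irreducible t) (x : M) (h : t • x = 0) : x = 0 :=
  (smul_eq_zero.1 h).resolve_left ht.ne_zero

lemma eis_pow (t : R) (θ : Module.End R M) (d : ℕ) (w : R[X])
    (h0 : ∀ x, aeval θ (X ^ d + C t * w) x = 0) (x : M) :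
    (θ ^ d) x = t • (- aeval θ w x) := by
  have h := h0 x
  rw [map_add, LinearMap.add_apply, aeval_X_pow, aeval_mul_apply, aeval_C_apply] at h
  rw [smul_neg]
  exact eq_neg_of_add_eq_zero_left h

lemma eis_length (t : R) (ht : Irreducible t) (θ : Module.End R M) (d : ℕ) (hd : 1 ≤ d) (w : R[X])
    (hw : IsUnit (w.coeff 0)) (h0 : ∀ x, aeval θ (X ^ d + C t * w) x = 0) :
    d * Module.length R (M ⧸ LinearMap.range θ) = Module.finrank R M := by
  have hp := eis_pow t θ d w h0
  have hb := aeval_bijective t ht.not_isUnit θ d (fun x => ⟨_, hp x⟩) w hw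
  have hinj : Function.Injective θ := by
    rw [injective_iff_map_eq_zero]
    intro x hx
    have h1 : (θ ^ d) x = 0 := by
      obtain ⟨n, rfl⟩ := Nat.exists_eq_add_of_le' hd
      rw [pow_succ, Module.End.mul_apply, hx, map_zero]
    rw [hp] at h1
    have h2 := smul_tor t ht _ h1
    rw [neg_eq_zero] at h2
    exact hb.1 (h2.trans (map_zero _).symm)
  rw [← length_quot_range_pow θ hinj, ← length_quot_smul t ht]
  have : LinearMap.range (θ ^ d) = LinearMap.range (t • (1 : Module.End R M)) := by
    ext x
    constructor
    · rintro ⟨y, rfl⟩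
      exact ⟨_, (hp y).symm⟩
    · rintro ⟨y, rfl⟩
      obtain ⟨z, rfl⟩ := hb.2 y
      refine ⟨-z, ?_⟩
      rw [hp]
      simp
  rw [this]

lemma eis_length_le_one (t : R) (ht : Irreducible t) (θ : Module.End R M) (d : ℕ) (hd : 1 ≤ d)
    (w : R[X]) (hw : IsUnit (w.coeff 0)) (h0 : ∀ x, aeval θ (X ^ d + C t * w) x = 0)
    (hr : Module.finrank R M ≤ d) :
    Module.length R (M ⧸ LinearMap.range θ) ≤ 1 := by
  have h := eis_length t ht θ d hd w hw h0
  by_contra hlt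
  have h2 : (2 : ℕ∞) ≤ Module.length R (M ⧸ LinearMap.range θ) := by
    rw [not_le] at hlt
    simpa [one_add_one_eq_two] using Order.add_one_le_of_lt hlt
  have h3 : (d : ℕ∞) * 2 ≤ d := by
    calc (d : ℕ∞) * 2 ≤ d * Module.length R (M ⧸ LinearMap.range θ) := by gcongr
      _ = Module.finrank R M := h
      _ ≤ d := by exact_mod_cast hr
  have h4 : d * 2 ≤ d := by exact_mod_cast h3
  omega
end

/-- The induction. -/
theorem main_induction (t : R) (ht : Irreducible t) (σ : ℕ) (m : ℕ) :
    ∀ {V : Type*} [AddCommGroup V] [Module R V] [Module.Free R V] [Module.Finite R V]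
    (W : ℕ → Submodule R V) (θ : Module.End R V)
    (_ : W 0 = ⊤) (_ : ∀ x, x ∈ W σ ↔ ∃ y, x = t • y)
    (_ : ∀ i < σ, W (i + 1) ≤ W i)
    (_ : ∀ i < σ, ∀ x ∈ W i, θ x ∈ W (i + 1))
    (f w : ℕ → R[X]) (d : ℕ → ℕ)
    (_ : ∀ i < m, f i = X ^ (d i) + C t * w i)
    (_ : ∀ i < m, IsUnit ((w i).coeff 0))
    (_ : ∀ i < m, ∀ j < m, i ≠ j → IsUnit ((w i).coeff 0 - (w j).coeff 0))
    (_ : ∀ i < m, 1 ≤ d i)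
    (_ : ∀ i < m, d i = ((Finset.range σ).filter (fun j => ((i + 1 : ℕ) : ℕ∞) ≤
      Module.length R (↥(W j) ⧸ (W (j+1)).comap (W j).subtype))).card)
    (_ : ∀ i < m, Module.finrank R (LinearMap.ker (aeval θ (f i))) = d i)
    (_ : aeval θ (∏ i ∈ Finset.range m, f i) = 0) (v : V),
    ∃ x : ℕ → V, (∀ i < m, aeval θ (f i) (x i) = 0) ∧ v = ∑ i ∈ Finset.range m, x i := by
  classical
  induction m with
  | zero =>
    intro V _ _ _ _ W θ _ _ _ _ f w d _ _ _ _ _ _ hann v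
    refine ⟨fun _ => 0, by simp, ?_⟩
    simpa using LinearMap.congr_fun hann v
  | succ m ih =>
    intro V _ _ _ _ W θ hW0 hWσ hle hθ f w d hf hw hww hd1 hd hker hann v
    set ℓ : ℕ → ℕ∞ := fun j => Module.length R (↥(W j) ⧸ (W (j+1)).comap (W j).subtype) with hℓ
    have hℓ0 : ∀ j, ℓ j = 0 ↔ W j ≤ W (j + 1) := fun j => length_gr_eq_zero_iff _ _
    have hd0 : d 0 = ((Finset.range σ).filter (fun j => ¬ W j ≤ W (j+1))).card := by
      rw [hd 0 (by omega)]
      congr 1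
      ext j
      rw [Finset.mem_filter, Finset.mem_filter, ← hℓ0]
      simp [hℓ, Order.one_le_iff_ne_zero]
    have hdle : ∀ i < m, d (i + 1) ≤ d 0 := by
      intro i hi
      rw [hd 0 (by omega), hd (i+1) (by omega)]
      apply Finset.card_le_card
      intro j
      simp only [Finset.mem_filter]
      rintro ⟨h1, h2⟩
      refine ⟨h1, le_trans ?_ h2⟩
      exact_mod_cast (by omega)
    have hpow := filt_pow_smul t σ W θ hW0 (fun x hx => (hWσ x).1 hx) hle hθ
    rw [← hd0] at hpow
    -- the comparison polynomials
    let e : ℕ → ℕ := fun j => d 0 - d (j + 1)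
    let u : ℕ → R[X] := fun j => w 0 - X ^ (e j) * w (j + 1)
    have hfu : ∀ j ∈ Finset.range m, f 0 - X ^ (e j) * f (j + 1) = C t * u j := by
      intro j hj
      rw [Finset.mem_range] at hj
      have : (X : R[X]) ^ d 0 = X ^ (e j) * X ^ (d (j + 1)) := by
        rw [← pow_add]; congr 1; have := hdle j hj; simp only [e]; omega
      rw [hf 0 (by omega), hf (j+1) (by omega), this]
      simp only [u]
      ring
    have hu : ∀ j ∈ Finset.range m, IsUnit ((u j).coeff 0) := by
      intro j hj
      rw [Finset.mem_range] at hj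
      simp only [u, coeff_sub, mul_coeff_zero, coeff_X_pow]
      split_ifs with h
      · rw [one_mul]; exact hww 0 (by omega) (j+1) (by omega) (by omega)
      · rw [zero_mul, sub_zero]; exact hw 0 (by omega)
    rw [Finset.prod_range_succ', mul_comm] at hann
    set F : R[X] := ∏ j ∈ Finset.range m, f (j + 1) with hF
    set P := LinearMap.ker (aeval θ (f 0)) with hP
    set Q := LinearMap.ker (aeval θ F) with hQ
    have hstab : ∀ p : R[X], ∀ x ∈ LinearMap.ker (aeval θ p), θ x ∈ LinearMap.ker (aeval θ p) := by
      intro p x hx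
      rw [LinearMap.mem_ker] at hx ⊢
      have := aeval_comm_apply θ p X x
      rw [aeval_X] at this
      rw [this, hx, map_zero]
    have hPQ : ∀ x ∈ P, x ∈ Q → x = 0 := by
      intro x hxP hxQ
      refine splitting_disjoint t ht.not_isUnit (smul_tor t ht) θ (d 0) ?_ (f 0) (Finset.range m)
        (fun j => f (j + 1)) u e hfu hu x hxP hxQ
      intro x
      obtain ⟨y, _, hy⟩ := hpow 0 (by omega) x (by rw [hW0]; trivial)
      exact ⟨y, hy⟩
    have hWstab : ∀ a ≤ σ, ∀ x ∈ W a, θ x ∈ W a := by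
      intro a ha x hx
      rcases ha.lt_or_eq with h | rfl
      · exact hle a h (hθ a h x hx)
      · obtain ⟨y, rfl⟩ := (hWσ x).1 hx
        exact (hWσ _).2 ⟨θ y, map_smul _ _ _⟩
    have hsplit : ∀ a ≤ σ, ∀ x ∈ W a, ∃ y ∈ P, ∃ z ∈ Q, y ∈ W a ∧ z ∈ W a ∧ x = y + z := by
      intro a ha x hx
      obtain ⟨y, z, h1, h2, h3⟩ := splitting (M := W a) t ht.not_isUnit (smul_tor t ht)
        (θ.restrict (hWstab a ha)) (d 0) (by
          intro x
          obtain ⟨y, hy, hxy⟩ := hpow a ha x x.2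
          refine ⟨⟨y, hy⟩, ?_⟩
          apply Subtype.ext
          rw [← aeval_X_pow (R := R), aeval_restrict, aeval_X_pow, hxy]
          rfl) (f 0) (w 0) (hf 0 (by omega)) (Finset.range m) (fun j => f (j + 1)) u e hfu hu
          (by
            ext x
            rw [aeval_restrict]
            rw [hann]
            rfl) ⟨x, hx⟩
      refine ⟨y, ?_, z, ?_, y.2, z.2, congrArg Subtype.val h1⟩
      · rw [hP, LinearMap.mem_ker, ← aeval_restrict θ _ (hWstab a ha), h2]; rfl
      · rw [hQ, LinearMap.mem_ker, ← aeval_restrict θ _ (hWstab a ha), h3]; rfl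
    -- filtration on P
    let WP : ℕ → Submodule R P := fun j => (W j).comap P.subtype
    let WQ : ℕ → Submodule R Q := fun j => (W j).comap Q.subtype
    let a : ℕ → ℕ∞ := fun j => Module.length R (↥(WP j) ⧸ (WP (j+1)).comap (WP j).subtype)
    let b : ℕ → ℕ∞ := fun j => Module.length R (↥(WQ j) ⧸ (WQ (j+1)).comap (WQ j).subtype)
    have hab : ∀ j < σ, ℓ j = a j + b j := fun j hj =>
      length_split P Q (W j) (W (j+1)) hPQ (hsplit j (by omega)) (hsplit (j+1) (by omega))
    have hWσ' : ∀ p : R[X], ∀ x : LinearMap.ker (aeval θ p),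
        x ∈ (W σ).comap (LinearMap.ker (aeval θ p)).subtype ↔ ∃ y, x = t • y := by
      intro p x
      rw [Submodule.mem_comap, hWσ]
      constructor
      · rintro ⟨y, hy⟩
        have hy' : (x : V) = t • y := hy
        refine ⟨⟨y, ?_⟩, Subtype.ext hy'⟩
        rw [LinearMap.mem_ker]
        apply smul_tor t ht
        rw [← map_smul, ← hy']
        exact x.2
      · rintro ⟨y, rfl⟩
        exact ⟨y, rfl⟩
    let θP : Module.End R P := θ.restrict (hstab (f 0))
    let θQ : Module.End R Q := θ.restrict (hstab F)
    have haveP : ∀ x, aeval θP (f 0) x = 0 := by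
      intro x
      apply Subtype.ext
      rw [aeval_restrict]
      exact x.2
    have ha1 : ∀ j < σ, a j ≤ 1 := by
      intro j hj
      have hs : ∀ x ∈ WP j, θP x ∈ WP j := fun x hx => hWstab j (by omega) x hx
      have h1 := eis_length_le_one t ht (θP.restrict hs) (d 0) (hd1 0 (by omega)) (w 0)
        (hw 0 (by omega)) (by
          intro x
          apply Subtype.ext
          rw [aeval_restrict, ← hf 0 (by omega), haveP]
          rfl) (by
          rw [← hker 0 (by omega)]
          exact Submodule.finrank_le _)
      refine le_trans ?_ h1
      refine Module.length_le_of_surjective (Submodule.mapQ _ _ LinearMap.id ?_) ?_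
      · rintro _ ⟨x, rfl⟩
        exact hθ j hj _ x.2
      · rw [← LinearMap.range_eq_top, Submodule.range_mapQ]
        simp
    have hasum : ∑ j ∈ Finset.range σ, a j = d 0 := by
      have h1 := length_chain σ WP (by simp [WP, hW0])
        (fun i hi => Submodule.comap_mono (hle i hi))
      have h2 : WP σ = LinearMap.range (t • (1 : Module.End R P)) := by
        ext x
        rw [hWσ' (f 0) x]
        constructor
        · rintro ⟨y, rfl⟩; exact ⟨y, rfl⟩
        · rintro ⟨y, rfl⟩; exact ⟨y, rfl⟩
      rw [h2, length_quot_smul t ht, hker 0 (by omega)] at h1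
      exact h1.symm
    have hale : ∀ j ∈ Finset.range σ, a j ≤ if ℓ j ≠ 0 then 1 else 0 := by
      intro j hj
      split_ifs with h
      · exact ha1 j (Finset.mem_range.1 hj)
      · rw [not_not] at h
        rw [← h, hab j (Finset.mem_range.1 hj)]
        exact le_self_add
    have hd0' : (d 0 : ℕ∞) = ∑ j ∈ Finset.range σ, if ℓ j ≠ 0 then 1 else 0 := by
      rw [hd0, Finset.sum_ite, Finset.sum_const_zero, add_zero, Finset.sum_const, nsmul_one]
      congr 3
      ext j
      exact (hℓ0 j).symm.not
    have haeq : ∀ j < σ, a j = if ℓ j ≠ 0 then 1 else 0 := by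
      by_contra! hne
      obtain ⟨j, hj, hne⟩ := hne
      have hjm := Finset.mem_range.2 hj
      have hlt : a j < if ℓ j ≠ 0 then 1 else 0 := lt_of_le_of_ne (hale j hjm) hne
      have hrest := Finset.sum_le_sum (s := (Finset.range σ).erase j)
        (fun i hi => hale i (Finset.mem_of_mem_erase hi))
      have e1 := hasum
      rw [hd0', ← Finset.add_sum_erase _ _ hjm, ← Finset.add_sum_erase _ _ hjm] at e1
      have hfin : (∑ x ∈ (Finset.range σ).erase j, a x) ≠ ⊤ := by
        refine ne_top_of_le_ne_top (ENat.natCast_ne_top (d 0)) ?_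
        rw [← hasum]
        exact Finset.sum_le_sum_of_subset (Finset.erase_subset _ _)
      exact absurd e1 (ENat.add_lt_add_of_lt_of_le hfin hlt hrest).ne
    have hbcount : ∀ i < m, d (i + 1) = ((Finset.range σ).filter
        (fun j => ((i + 1 : ℕ) : ℕ∞) ≤ b j)).card := by
      intro i hi
      rw [hd (i + 1) (by omega)]
      congr 1
      apply Finset.filter_congr
      intro j hj
      rw [Finset.mem_range] at hj
      change _ ≤ ℓ j ↔ _
      have h1 := hab j hj
      rw [haeq j hj] at h1
      split_ifs at h1 with h
      · rw [h1]
        have : ((i + 1 + 1 : ℕ) : ℕ∞) = 1 + ((i + 1 : ℕ) : ℕ∞) := by push_cast; ring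
        rw [this, ENat.add_le_add_iff_left (by simp)]
      · rw [zero_add] at h1
        rw [not_not] at h
        rw [← h1, h]
        simp
    have hkerle : ∀ i < m, LinearMap.ker (aeval θ (f (i + 1))) ≤ Q := by
      intro i hi x hx
      rw [LinearMap.mem_ker] at hx
      rw [hQ, LinearMap.mem_ker, hF, ← Finset.prod_erase_mul _ _ (Finset.mem_range.2 hi),
        aeval_mul_apply, hx, map_zero]
    obtain ⟨y, hy, z, hz, -, -, hvyz⟩ := hsplit 0 (by omega) v (by rw [hW0]; trivial)
    obtain ⟨x, hx1, hx2⟩ := ih WQ θQ (by simp [WQ, hW0]) (hWσ' F)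
      (fun i hi => Submodule.comap_mono (hle i hi))
      (fun i hi x hx => hθ i hi x hx) (fun i => f (i + 1)) (fun i => w (i + 1)) (fun i => d (i + 1))
      (fun i hi => hf _ (by omega)) (fun i hi => hw _ (by omega))
      (fun i hi j hj hij => hww _ (by omega) _ (by omega) (by omega))
      (fun i hi => hd1 _ (by omega)) hbcount
      (by
        intro i hi
        rw [← hker (i + 1) (by omega)]
        rw [← (Submodule.comapSubtypeEquivOfLe (hkerle i hi)).finrank_eq]
        have : LinearMap.ker (aeval θQ (f (i + 1))) =
            (LinearMap.ker (aeval θ (f (i + 1)))).comap Q.subtype := by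
          ext x
          rw [LinearMap.mem_ker, Submodule.mem_comap, LinearMap.mem_ker, Submodule.subtype_apply,
            ← aeval_restrict θ Q (hstab F)]
          exact Subtype.ext_iff
        rw [this])
      (by
        ext x
        rw [aeval_restrict]
        exact x.2) ⟨z, hz⟩
    refine ⟨fun i => if i = 0 then y else x (i - 1), ?_, ?_⟩
    · intro i hi
      rcases i with _ | i
      · exact hy
      · have := hx1 i (by omega)
        simp only [Nat.add_eq_zero_iff, one_ne_zero, and_false, if_false, Nat.add_sub_cancel]
        rw [← aeval_restrict θ Q (hstab F)]
        exact congrArg Subtype.val this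
    · rw [Finset.sum_range_succ', hvyz, add_comm]
      have := congrArg Subtype.val hx2
      simp only [Submodule.coe_sum] at this
      simp [this]

end DVR

section Charpoly

lemma charpoly_mul {R : Type*} [CommRing R] [IsDomain R] [Infinite R]
    {V : Type*} [AddCommGroup V] [Module R V] [Module.Free R V] [Module.Finite R V]
    (P : Submodule R V) [Module.Free R P] [Module.Finite R P] [Module.Free R (V ⧸ P)]
    (θ : Module.End R V) (hP : P ≤ P.comap θ) :
    θ.charpoly = LinearMap.charpoly (θ.restrict hP) * LinearMap.charpoly (P.mapQ P θ hP) := by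
  apply Polynomial.funext
  intro c
  rw [eval_mul, LinearMap.eval_charpoly, LinearMap.eval_charpoly, LinearMap.eval_charpoly]
  have h : P ≤ P.comap (algebraMap R (Module.End R V) c - θ) := by
    intro x hx
    exact P.sub_mem (P.smul_mem c hx) (hP hx)
  rw [LinearMap.det_eq_det_mul_det P _ h]
  congr 2
  ext x
  rfl

lemma charpoly_root {R : Type*} [CommRing R] [IsDomain R]
    {V : Type*} [AddCommGroup V] [Module R V] [Module.Free R V] [Module.Finite R V]
    {L : Type*} [Field L] [Algebra R L] (θ : Module.End R V) (a : R[X]) (ha : aeval θ a = 0)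
    (α : L) (hα : aeval α θ.charpoly = 0) : aeval α a = 0 := by
  have h1 : (LinearMap.charpoly (θ.baseChange L)).IsRoot α := by
    rw [LinearMap.charpoly_baseChange, IsRoot, eval_map_algebraMap]
    exact hα
  rw [← Module.End.hasEigenvalue_iff_isRoot_charpoly] at h1
  obtain ⟨v, hv⟩ := h1.exists_hasEigenvector
  have h2 := Module.End.aeval_apply_of_hasEigenvector (p := a.map (algebraMap R L)) hv
  have h3 : aeval (θ.baseChange L) (a.map (algebraMap R L)) = 0 := by
    have := Polynomial.aeval_algHom_apply (Module.End.baseChangeHom R L V) θ a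
    rw [ha, map_zero] at this
    rw [aeval_map_algebraMap]
    exact this
  rw [h3, LinearMap.zero_apply, eval_map_algebraMap] at h2
  exact (smul_eq_zero.1 h2.symm).resolve_right hv.2

lemma finrank_ker_le (K : Type*) [Field K] {R : Type*} [CommRing R] [IsDomain R] [IsPrincipalIdealRing R] [Infinite R]
    [Algebra R K]
    {V : Type*} [AddCommGroup V] [Module R V] [Module.Free R V] [Module.Finite R V]
    (θ : Module.End R V) (a b : R[X]) (ha : a.Monic) (hab : θ.charpoly = a * b)
    (hco : IsCoprime (a.map (algebraMap R (K))) (b.map (algebraMap R (K)))) :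
    Module.finrank R (LinearMap.ker (aeval θ a)) ≤ a.natDegree := by
  set P := LinearMap.ker (aeval θ a) with hPdef
  have hP : P ≤ P.comap θ := by
    intro x hx
    rw [Submodule.mem_comap]
    rw [hPdef, LinearMap.mem_ker] at hx ⊢
    have := aeval_comm_apply θ a X x
    rw [aeval_X] at this
    rw [this, hx, map_zero]
  have : Module.Free R (V ⧸ P) :=
    Module.Free.of_equiv (LinearMap.quotKerEquivRange (aeval θ a)).symm
  have hmul := charpoly_mul P θ hP
  set p := LinearMap.charpoly (θ.restrict hP) with hp
  have hpm : p.Monic := LinearMap.charpoly_monic _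
  rw [← LinearMap.charpoly_natDegree (θ.restrict hP), ← hp]
  have hcop : IsCoprime (p.map (algebraMap R (K)))
      (b.map (algebraMap R (K))) := by
    rw [Polynomial.isCoprime_iff_aeval_ne_zero_of_isAlgClosed K
      (AlgebraicClosure (K))] at hco ⊢
    intro α
    by_contra! h
    obtain ⟨h1, h2⟩ := h
    rcases hco α with h3 | h3
    · apply h3
      rw [aeval_map_algebraMap] at h1 ⊢
      refine charpoly_root (θ.restrict hP) a ?_ α h1
      ext x
      rw [aeval_restrict θ P hP]
      exact x.2
    · exact h3 h2
  have hdvd : p.map (algebraMap R (K)) ∣ a.map (algebraMap R (K)) := by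
    apply hcop.dvd_of_dvd_mul_right
    rw [← Polynomial.map_mul, ← hab, hmul, Polynomial.map_mul]
    exact dvd_mul_right _ _
  have := natDegree_le_of_dvd hdvd (ha.map _).ne_zero
  rwa [hpm.natDegree_map, ha.natDegree_map] at this

lemma finrank_ker_mul_le {R : Type*} [CommRing R] [IsDomain R] [IsPrincipalIdealRing R]
    {V : Type*} [AddCommGroup V] [Module R V] [Module.Free R V] [Module.Finite R V]
    (A B : Module.End R V) :
    Module.finrank R (LinearMap.ker (A * B)) ≤
      Module.finrank R (LinearMap.ker B) + Module.finrank R (LinearMap.ker A) := by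
  have hle : LinearMap.ker B ≤ LinearMap.ker (A * B) := by
    intro x hx
    rw [LinearMap.mem_ker] at hx ⊢
    rw [Module.End.mul_apply, hx, map_zero]
  let g : LinearMap.ker (A * B) →ₗ[R] LinearMap.ker A :=
    (B ∘ₗ (LinearMap.ker (A * B)).subtype).codRestrict _ (fun x => x.2)
  have h1 := (LinearMap.ker g).finrank_quotient_add_finrank
  rw [g.quotKerEquivRange.finrank_eq] at h1
  have h2 : Module.finrank R (LinearMap.ker g) = Module.finrank R (LinearMap.ker B) := by
    have : LinearMap.ker g = (LinearMap.ker B).comap (LinearMap.ker (A * B)).subtype := by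
      ext x
      rw [LinearMap.mem_ker, Submodule.mem_comap, LinearMap.mem_ker]
      exact Subtype.ext_iff
    rw [this, (Submodule.comapSubtypeEquivOfLe hle).finrank_eq]
  have h3 := Submodule.finrank_le (LinearMap.range g)
  omega

lemma finrank_le_sum {R : Type*} [CommRing R] [IsDomain R] [IsPrincipalIdealRing R]
    {V : Type*} [AddCommGroup V] [Module R V] [Module.Free R V] [Module.Finite R V]
    (θ : Module.End R V) (S : Finset ℕ) (f : ℕ → R[X]) :
    Module.finrank R (LinearMap.ker (aeval θ (∏ i ∈ S, f i))) ≤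
      ∑ i ∈ S, Module.finrank R (LinearMap.ker (aeval θ (f i))) := by
  classical
  induction S using Finset.induction_on with
  | empty =>
    have : LinearMap.ker (aeval θ (∏ i ∈ (∅ : Finset ℕ), f i)) = ⊥ := by
      rw [LinearMap.ker_eq_bot]; intro x y h; simpa using h
    rw [this]; simp
  | insert j T hj ih =>
    rw [Finset.prod_insert hj, Finset.sum_insert hj, map_mul]
    have := finrank_ker_mul_le (aeval θ (f j)) (aeval θ (∏ i ∈ T, f i))
    omega

/-- Exact ranks of the kernels. -/
lemma finrank_ker_eq (K : Type*) [Field K] {R : Type*} [CommRing R] [IsDomain R] [IsPrincipalIdealRing R] [Infinite R]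
    [Algebra R K] [IsFractionRing R K]
    {V : Type*} [AddCommGroup V] [Module R V] [Module.Free R V] [Module.Finite R V]
    (θ : Module.End R V) (S : Finset ℕ) (f : ℕ → R[X]) (hm : ∀ i ∈ S, (f i).Monic)
    (hirr : ∀ i ∈ S, Irreducible (f i)) (hne : ∀ i ∈ S, ∀ j ∈ S, i ≠ j → f i ≠ f j)
    (hchar : θ.charpoly = ∏ i ∈ S, f i) :
    ∀ i ∈ S, Module.finrank R (LinearMap.ker (aeval θ (f i))) = (f i).natDegree := by
  classical
  have hle : ∀ i ∈ S, Module.finrank R (LinearMap.ker (aeval θ (f i))) ≤ (f i).natDegree := by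
    intro i hi
    refine finrank_ker_le K θ (f i) (∏ j ∈ S.erase i, f j) (hm i hi) ?_ ?_
    · rw [hchar, Finset.mul_prod_erase _ _ hi]
    · rw [Polynomial.map_prod]
      apply IsCoprime.prod_right
      intro j hj
      rw [Finset.mem_erase] at hj
      have hi' := ((hm i hi).irreducible_iff_irreducible_map_fraction_map
        (K := K)).1 (hirr i hi)
      have hj' := ((hm j hj.2).irreducible_iff_irreducible_map_fraction_map
        (K := K)).1 (hirr j hj.2)
      rw [hi'.coprime_iff_not_dvd]
      intro hdvd
      have hassoc := hi'.associated_of_dvd hj' hdvd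
      have heq := eq_of_monic_of_associated ((hm i hi).map _) ((hm j hj.2).map _) hassoc
      exact hne i hi j hj.2 (Ne.symm hj.1)
        (Polynomial.map_injective _ (IsFractionRing.injective R K) heq)
  have hsum : ∑ i ∈ S, (f i).natDegree ≤
      ∑ i ∈ S, Module.finrank R (LinearMap.ker (aeval θ (f i))) := by
    rw [← natDegree_prod_of_monic S f hm, ← hchar, LinearMap.charpoly_natDegree]
    have h1 := finrank_le_sum θ S f
    rw [← hchar, LinearMap.aeval_self_charpoly, LinearMap.ker_zero, finrank_top] at h1
    exact h1
  exact (Finset.sum_eq_sum_iff_of_le hle).1 (le_antisymm (Finset.sum_le_sum hle) hsum)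

end Charpoly

section Cyclic
variable {R : Type*} [CommRing R] [IsDomain R] [IsDiscreteValuationRing R]
variable {M : Type*} [AddCommGroup M] [Module R M] [Module.Free R M] [Module.Finite R M]

lemma cyclic_equiv (t : R) (ht : Irreducible t) (θ : Module.End R M) (f w : R[X])
    (hm : f.Monic) (hd : 1 ≤ f.natDegree) (hf : f = X ^ f.natDegree + C t * w)
    (hw : IsUnit (w.coeff 0)) (h0 : aeval θ f = 0) (hr : Module.finrank R M = f.natDegree) :
    ∃ e : M ≃ₗ[R] (R[X] ⧸ Ideal.span {f}),
      ∀ v, e (θ v) = Ideal.Quotient.mk (Ideal.span {f}) X * e v := by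
  have h0' : ∀ x, aeval θ (X ^ f.natDegree + C t * w) x = 0 := by
    intro x; rw [← hf, h0]; rfl
  have hlen : Module.length R (M ⧸ LinearMap.range θ) = 1 := by
    apply le_antisymm (eis_length_le_one t ht θ f.natDegree hd w hw h0' hr.le)
    rw [Order.one_le_iff_ne_zero]
    intro h
    have := eis_length t ht θ f.natDegree hd w hw h0'
    rw [h, mul_zero, hr] at this
    have : f.natDegree = 0 := by exact_mod_cast this.symm
    omega
  rw [Module.length_eq_one_iff] at hlen
  have hnt : Nontrivial (M ⧸ LinearMap.range θ) := IsSimpleModule.nontrivial R _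
  obtain ⟨q, hq⟩ := exists_ne (0 : M ⧸ LinearMap.range θ)
  obtain ⟨v, rfl⟩ := Submodule.mkQ_surjective _ q
  have hgen : ∀ x : M, ∃ (c : R) (y : M), x = c • v + θ y := by
    intro x
    have h1 := IsSimpleModule.toSpanSingleton_surjective R hq ((LinearMap.range θ).mkQ x)
    obtain ⟨c, hc⟩ := h1
    rw [LinearMap.toSpanSingleton_apply, ← map_smul] at hc
    have h2 : x - c • v ∈ LinearMap.range θ := by
      rw [← Submodule.Quotient.mk_eq_zero, ← Submodule.mkQ_apply, map_sub, hc, sub_self]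
    obtain ⟨y, hy⟩ := h2
    exact ⟨c, y, by rw [hy]; abel⟩
  let A : (R[X] ⧸ Ideal.span {f}) →ₐ[R] Module.End R M :=
    Ideal.Quotient.liftₐ (Ideal.span {f}) (aeval θ) (by
      intro a ha
      obtain ⟨b, rfl⟩ := Ideal.mem_span_singleton.1 ha
      rw [map_mul, h0, zero_mul])
  have hA : ∀ p, A (Ideal.Quotient.mk _ p) = aeval θ p := fun p => rfl
  let ev : (R[X] ⧸ Ideal.span {f}) →ₗ[R] M := LinearMap.applyₗ v ∘ₗ A.toLinearMap
  have hev : ∀ p, ev p = A p v := fun p => rfl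
  have hsurj : Function.Surjective ev := by
    rw [← LinearMap.range_eq_top, ← top_le_iff]
    refine Submodule.le_of_le_smul_of_le_jacobson_bot (I := Ideal.span {t}) Module.Finite.fg_top ?_ ?_
    · rw [IsLocalRing.jacobson_eq_maximalIdeal ⊥ bot_ne_top, Ideal.span_singleton_le_iff_mem]
      exact ht.not_isUnit
    · intro x _
      have key : ∀ n : ℕ, ∀ x, ∃ (p : R[X]) (y : M), x = aeval θ p v + (θ ^ n) y := by
        intro n
        induction n with
        | zero => intro x; exact ⟨0, x, by simp⟩
        | succ n ih =>
          intro x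
          obtain ⟨p, y, rfl⟩ := ih x
          obtain ⟨c, z, rfl⟩ := hgen y
          refine ⟨p + X ^ n * C c, z, ?_⟩
          rw [map_add, map_add, LinearMap.add_apply, aeval_mul_apply, aeval_C_apply, aeval_X_pow,
            pow_succ, Module.End.mul_apply, add_assoc]
      obtain ⟨p, y, rfl⟩ := key f.natDegree x
      refine Submodule.add_mem_sup ⟨Ideal.Quotient.mk _ p, rfl⟩ ?_
      rw [eis_pow t θ _ w h0']
      exact Submodule.smul_mem_smul (Ideal.mem_span_singleton_self t) trivial
  have : Module.Free R (R[X] ⧸ Ideal.span {f}) := hm.free_adjoinRoot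
  have : Module.Finite R (R[X] ⧸ Ideal.span {f}) := hm.finite_adjoinRoot
  have hrk : Module.finrank R (R[X] ⧸ Ideal.span {f}) = Module.finrank R M := by
    rw [finrank_quotient_span_eq_natDegree' hm, hr]
  let i : M ≃ₗ[R] (R[X] ⧸ Ideal.span {f}) := LinearEquiv.ofFinrankEq _ _ hrk.symm
  have hinj : Function.Injective ev := by
    have := OrzechProperty.injective_of_surjective_endomorphism (ev ∘ₗ i.toLinearMap)
      (hsurj.comp i.surjective)
    intro a b hab
    apply i.symm.injective
    apply this
    simpa using hab
  let e := LinearEquiv.ofBijective ev ⟨hinj, hsurj⟩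
  refine ⟨e.symm, fun x => ?_⟩
  apply e.injective
  rw [LinearEquiv.apply_symm_apply]
  obtain ⟨y, rfl⟩ := e.surjective x
  rw [LinearEquiv.symm_apply_apply]
  change θ (A y v) = A (_ * y) v
  rw [map_mul, hA, aeval_X]
  rfl

end Cyclic

section Final

lemma unit_of_notMem {R : Type*} [CommRing R] [IsDomain R] [IsDiscreteValuationRing R]
    (t : R) (ht : Irreducible t) (u : R) (hu : t * u ∉ Ideal.span {t} ^ 2) : IsUnit u := by
  by_contra h
  apply hu
  have h1 : u ∈ IsLocalRing.maximalIdeal R := h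
  rw [ht.maximalIdeal_eq, Ideal.mem_span_singleton] at h1
  rw [Ideal.span_singleton_pow, Ideal.mem_span_singleton, pow_two]
  exact mul_dvd_mul_left t h1

lemma eis_form {R : Type*} [CommRing R] [IsDomain R] [IsDiscreteValuationRing R]
    (t : R) (ht : Irreducible t) (f : R[X]) (hm : f.Monic) (hd : 1 ≤ f.natDegree)
    (hE : f.IsEisensteinAt (Ideal.span {t})) :
    ∃ w : R[X], f = X ^ f.natDegree + C t * w ∧ f.coeff 0 = t * w.coeff 0 ∧
      IsUnit (w.coeff 0) := by
  have h1 : C t ∣ f - X ^ f.natDegree := by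
    rw [C_dvd_iff_dvd_coeff]
    intro i
    rw [coeff_sub, coeff_X_pow]
    rcases lt_trichotomy i f.natDegree with h | h | h
    · rw [if_neg h.ne, sub_zero]
      exact Ideal.mem_span_singleton.1 (hE.mem h)
    · rw [if_pos h, h, hm.coeff_natDegree, sub_self]
      exact dvd_zero _
    · rw [if_neg h.ne', coeff_eq_zero_of_natDegree_lt h, sub_self]
      exact dvd_zero _
  obtain ⟨w, hw⟩ := h1
  have h2 : f = X ^ f.natDegree + C t * w := by rw [← hw]; ring
  have h3 : f.coeff 0 = t * w.coeff 0 := by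
    have h4 := congrArg (fun p => p.coeff 0) hw
    simp only [coeff_sub, coeff_C_mul, coeff_X_pow] at h4
    rwa [if_neg (by omega), sub_zero] at h4
  refine ⟨w, h2, h3, unit_of_notMem t ht _ ?_⟩
  rw [← h3]
  exact hE.notMem

lemma length_eq_finrank_ps {k : Type*} [Field k] {M : Type*} [AddCommGroup M]
    [Module (PowerSeries k) M] [Module.Finite (PowerSeries k) M]
    (h : ∀ x : M, (PowerSeries.X : PowerSeries k) • x = 0) :
    Module.length (PowerSeries k) M =
      Module.finrank k (RestrictScalars k (PowerSeries k) M) := by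
  letI : Module k M := Module.compHom M (algebraMap k (PowerSeries k))
  have : RingHomSurjective (PowerSeries.constantCoeff (R := k)) :=
    ⟨fun a => ⟨PowerSeries.C a, by simp⟩⟩
  let f : M →ₛₗ[PowerSeries.constantCoeff (R := k)] M :=
    ⟨⟨fun x => x, fun _ _ => rfl⟩, by
      intro p x
      change p • x = (PowerSeries.C (PowerSeries.constantCoeff p)) • x
      have h1 : PowerSeries.X ∣ p - PowerSeries.C (PowerSeries.constantCoeff p) := by
        rw [PowerSeries.X_dvd_iff]; simp
      obtain ⟨q, hq⟩ := h1
      rw [← sub_eq_zero, ← sub_smul, hq, mul_smul, h]⟩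
  have hf : Function.Bijective f := Function.bijective_id
  have : Module.Finite k M :=
    Module.Finite.of_surjective f hf.2
  refine Eq.trans ?_ (Module.length_eq_finrank k M)
  rw [Module.length, Module.length, WithBot.unbot_inj,
    Order.krullDim_eq_of_orderIso (Submodule.orderIsoMapComapOfBijective f hf)]

lemma assemble {R : Type*} [CommRing R] [IsDomain R] [IsDiscreteValuationRing R]
    {V : Type*} [AddCommGroup V] [Module R V] [Module.Free R V] [Module.Finite R V]
    {ι : Type*} [Fintype ι] [DecidableEq ι]
    (t : R) (ht : Irreducible t) (θ : Module.End R V) (f : ι → R[X])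
    (hm : ∀ i, (f i).Monic) (hd : ∀ i, 1 ≤ (f i).natDegree)
    (hf : ∀ i, ∃ w : R[X], f i = X ^ (f i).natDegree + C t * w ∧ IsUnit (w.coeff 0))
    (hrk : ∀ i, Module.finrank R (LinearMap.ker (aeval θ (f i))) = (f i).natDegree)
    (hsum : ∑ i, (f i).natDegree = Module.finrank R V)
    (hsurj : ∀ v : V, ∃ x : ι → V, (∀ i, aeval θ (f i) (x i) = 0) ∧ v = ∑ i, x i) :
    DirectSum.IsInternal (fun i => LinearMap.ker (aeval θ (f i))) ∧
    ∃ e : V ≃ₗ[R] ((i : ι) → R[X] ⧸ Ideal.span {f i}),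
      ∀ (v : V) (i : ι), e (θ v) i = Ideal.Quotient.mk (Ideal.span {f i}) X * e v i := by
  classical
  let N : ι → Submodule R V := fun i => LinearMap.ker (aeval θ (f i))
  have hN : ∀ i, N i ≤ (N i).comap θ := by
    intro i x hx
    have hx' : aeval θ (f i) x = 0 := hx
    change aeval θ (f i) (θ x) = 0
    have := aeval_comm_apply θ (f i) X x
    rw [aeval_X] at this
    rw [this, hx', map_zero]
  let s : ((i : ι) → N i) →ₗ[R] V := ∑ i, (N i).subtype ∘ₗ LinearMap.proj i
  have hs : ∀ x, s x = ∑ i, (x i : V) := by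
    intro x
    simp [s]
  have hss : Function.Surjective s := by
    intro v
    obtain ⟨x, hx, rfl⟩ := hsurj v
    exact ⟨fun i => ⟨x i, hx i⟩, by rw [hs]⟩
  have hfr : Module.finrank R V = Module.finrank R ((i : ι) → N i) := by
    rw [Module.finrank_pi_fintype, ← hsum]
    exact Finset.sum_congr rfl fun i _ => (hrk i).symm
  let j : V ≃ₗ[R] ((i : ι) → N i) := LinearEquiv.ofFinrankEq _ _ hfr
  have hsi : Function.Injective s := by
    have := OrzechProperty.injective_of_surjective_endomorphism (s ∘ₗ j.toLinearMap)
      (hss.comp j.surjective)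
    intro a b hab
    apply j.symm.injective
    apply this
    simpa using hab
  constructor
  · have h1 : ⇑(DirectSum.coeAddMonoidHom N) = s ∘ (DirectSum.linearEquivFunOnFintype R ι
        (fun i => N i)) := by
      funext x
      rw [Function.comp_apply, hs]
      have := DirectSum.coeLinearMap_eq_dfinsuppSum N x
      change DirectSum.coeLinearMap N x = _
      rw [this, DFinsupp.sum_eq_sum_fintype]
      · rfl
      · intro i; rfl
    change Function.Bijective (DirectSum.coeAddMonoidHom N)
    rw [h1]
    exact (show Function.Bijective s from ⟨hsi, hss⟩).comp (LinearEquiv.bijective _)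
  · have hc : ∀ i, ∃ e : N i ≃ₗ[R] (R[X] ⧸ Ideal.span {f i}),
        ∀ v, e ((θ.restrict (hN i)) v) = Ideal.Quotient.mk (Ideal.span {f i}) X * e v := by
      intro i
      obtain ⟨w, hw1, hw2⟩ := hf i
      refine cyclic_equiv t ht (θ.restrict (hN i)) (f i) w (hm i) (hd i) hw1 hw2 ?_ (hrk i)
      ext x
      rw [aeval_restrict θ (N i) (hN i)]
      exact x.2
    choose e he using hc
    let S : ((i : ι) → N i) ≃ₗ[R] V := LinearEquiv.ofBijective s ⟨hsi, hss⟩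
    refine ⟨S.symm ≪≫ₗ LinearEquiv.piCongrRight e, fun v i => ?_⟩
    obtain ⟨x, rfl⟩ := S.surjective v
    have h1 : θ (S x) = S (fun i => (θ.restrict (hN i)) (x i)) := by
      change θ (s x) = s _
      rw [hs, hs, map_sum]
      rfl
    rw [h1]
    simp only [LinearEquiv.trans_apply, LinearEquiv.symm_apply_apply,
      LinearEquiv.piCongrRight_apply]
    exact he i (x i)

end Final

end PLD



/-- **(Proposition 4.3 of the paper: decomposition of a local parabolic triple.)**
Let `k` be algebraically closed, `O = k[[t]]`, and `(V, W•, θ)` a local parabolic triple: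
`V` is free of rank `r` over `O` with filtration `V = W 0 ⊃ W 1 ⊃ ⋯ ⊃ W σ = t•V` whose graded
fiber dimensions rearrange to the partition `n` of `r` with conjugate `μ`; `θ(W i) ⊆ W (i+1)`;
and the characteristic polynomial of `θ` factors as `∏_{i=1}^{n 1} f i` with `f i` Eisenstein
of degree `μ i`, the constant terms of the `f i` being pairwise non-congruent mod `t²`.
Then `V = ⨁_{i=1}^{n 1} Ker fᵢ(θ)` (an internal direct sum), and consequently `V` is free of
rank one over `Ã = ∏_{i=1}^{n 1} O[λ]/(f i)` where `λ` acts as `θ`: there is an `O`-linear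
isomorphism `V ≅ ∏ᵢ O[λ]/(f i)` intertwining `θ` with multiplication by `λ`. -/
theorem parabolic_local_decomposition {k : Type*} [Field k] [IsAlgClosed k]
    {V : Type*} [AddCommGroup V] [Module (PowerSeries k) V]
    [Module.Free (PowerSeries k) V] [Module.Finite (PowerSeries k) V]
    (r σ : ℕ) (hr : 1 ≤ r) (hσ : 1 ≤ σ)
    (hrank : Module.finrank (PowerSeries k) V = r)
    (W : ℕ → Submodule (PowerSeries k) V)
    (hW0 : W 0 = ⊤)
    (hWσ : W σ = (PowerSeries.X : PowerSeries k) • (⊤ : Submodule (PowerSeries k) V))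
    (hchain : ∀ i < σ, W (i + 1) < W i)
    (n : ℕ → ℕ)
    (hanti : ∀ i j, 1 ≤ i → i ≤ j → j ≤ σ → n j ≤ n i)
    (hpos : ∀ i, 1 ≤ i → i ≤ σ → 0 < n i)
    (hsum : ∑ i ∈ Finset.Icc 1 σ, n i = r)
    (hdims : Multiset.map n (Finset.Icc 1 σ).val =
      Multiset.map (fun i => Module.finrank k (RestrictScalars k (PowerSeries k)
        (↥(W (i - 1)) ⧸ (W i).comap (W (i - 1)).subtype))) (Finset.Icc 1 σ).val)
    (μ : ℕ → ℕ)
    (hμ : ∀ t, μ t = ((Finset.Icc 1 σ).filter (fun l => t ≤ n l)).card)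
    (θ : Module.End (PowerSeries k) V)
    (hθ : ∀ i < σ, Submodule.map θ (W i) ≤ W (i + 1))
    (f : ℕ → Polynomial (PowerSeries k))
    (hmonic : ∀ i, 1 ≤ i → i ≤ n 1 → (f i).Monic)
    (hdeg : ∀ i, 1 ≤ i → i ≤ n 1 → (f i).natDegree = μ i)
    (hEis : ∀ i, 1 ≤ i → i ≤ n 1 →
      (f i).IsEisensteinAt (Ideal.span {(PowerSeries.X : PowerSeries k)}))
    (hconst : ∀ i j, 1 ≤ i → i ≤ n 1 → 1 ≤ j → j ≤ n 1 → i ≠ j →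
      ((f i).coeff 0 - (f j).coeff 0) ∉ Ideal.span {(PowerSeries.X : PowerSeries k)} ^ 2)
    (hchar : LinearMap.charpoly θ = ∏ i ∈ Finset.Icc 1 (n 1), f i) :
    DirectSum.IsInternal (fun i : {x // x ∈ Finset.Icc 1 (n 1)} =>
      LinearMap.ker (Polynomial.aeval θ (f ↑i))) ∧
    ∃ e : V ≃ₗ[PowerSeries k]
        ((i : {x // x ∈ Finset.Icc 1 (n 1)}) →
          Polynomial (PowerSeries k) ⧸ Ideal.span {f ↑i}),
      ∀ (v : V) (i : {x // x ∈ Finset.Icc 1 (n 1)}),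
        e (θ v) i = Ideal.Quotient.mk (Ideal.span {f ↑i}) Polynomial.X * e v i := by
  classical
  have hX : Irreducible (PowerSeries.X : PowerSeries k) := PowerSeries.X_irreducible
  have hk : Infinite k := inferInstance
  have : Infinite (PowerSeries k) :=
    Infinite.of_injective (PowerSeries.C (R := k)) PowerSeries.C_injective
  have hμpos : ∀ i, 1 ≤ i → i ≤ n 1 → 1 ≤ μ i := by
    intro i h1 h2
    rw [hμ, Nat.one_le_iff_ne_zero, Ne, Finset.card_eq_zero]
    intro h
    have : (1 : ℕ) ∈ (Finset.Icc 1 σ).filter (fun l => i ≤ n l) := by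
      simp [hσ, h2]
    rw [h] at this
    simp at this
  have hdpos : ∀ i, 1 ≤ i → i ≤ n 1 → 1 ≤ (f i).natDegree := fun i h1 h2 => by
    rw [hdeg i h1 h2]; exact hμpos i h1 h2
  have hform : ∀ i, ∃ w : Polynomial (PowerSeries k), 1 ≤ i → i ≤ n 1 →
      f i = Polynomial.X ^ (f i).natDegree + Polynomial.C PowerSeries.X * w ∧
      (f i).coeff 0 = PowerSeries.X * w.coeff 0 ∧ IsUnit (w.coeff 0) := by
    intro i
    by_cases h : 1 ≤ i ∧ i ≤ n 1
    · obtain ⟨w, hw⟩ := PLD.eis_form _ hX (f i) (hmonic i h.1 h.2) (hdpos i h.1 h.2)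
        (hEis i h.1 h.2)
      exact ⟨w, fun _ _ => hw⟩
    · exact ⟨0, fun h1 h2 => absurd ⟨h1, h2⟩ h⟩
  choose w hw using hform
  have hprime : (Ideal.span {(PowerSeries.X : PowerSeries k)}).IsPrime :=
    PowerSeries.span_X_isPrime
  have hker := PLD.finrank_ker_eq (FractionRing (PowerSeries k)) θ (Finset.Icc 1 (n 1)) f
    (fun i hi => hmonic i (Finset.mem_Icc.1 hi).1 (Finset.mem_Icc.1 hi).2)
    (fun i hi => (hEis i (Finset.mem_Icc.1 hi).1 (Finset.mem_Icc.1 hi).2).irreducible hprime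
      (hmonic i (Finset.mem_Icc.1 hi).1 (Finset.mem_Icc.1 hi).2).isPrimitive
      (hdpos i (Finset.mem_Icc.1 hi).1 (Finset.mem_Icc.1 hi).2))
    (fun i hi j hj hij h => by
      apply hconst i j (Finset.mem_Icc.1 hi).1 (Finset.mem_Icc.1 hi).2
        (Finset.mem_Icc.1 hj).1 (Finset.mem_Icc.1 hj).2 hij
      rw [h, sub_self]
      exact zero_mem _) hchar
  have hWσ' : ∀ x, x ∈ W σ ↔ ∃ y, x = (PowerSeries.X : PowerSeries k) • y := by
    intro x
    rw [hWσ, Submodule.mem_smul_pointwise_iff_exists]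
    constructor
    · rintro ⟨y, -, rfl⟩
      exact ⟨y, rfl⟩
    · rintro ⟨y, rfl⟩
      exact ⟨y, trivial, rfl⟩
  have hWge : ∀ j, j ≤ σ → W σ ≤ W j := by
    intro j hj
    induction hj using Nat.decreasingInduction with
    | self => exact le_rfl
    | of_succ i hi ih => exact ih.trans (hchain i hi).le
  have hlen : ∀ j, j < σ → Module.length (PowerSeries k)
      (↥(W j) ⧸ (W (j + 1)).comap (W j).subtype) =
      Module.finrank k (RestrictScalars k (PowerSeries k)
        (↥(W j) ⧸ (W (j + 1)).comap (W j).subtype)) := by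
    intro j hj
    apply PLD.length_eq_finrank_ps
    intro x
    obtain ⟨y, rfl⟩ := Submodule.mkQ_surjective _ x
    rw [← map_smul, Submodule.mkQ_apply, Submodule.Quotient.mk_eq_zero, Submodule.mem_comap]
    exact hWge (j + 1) hj ((hWσ' _).2 ⟨y, rfl⟩)
  have hcount : ∀ i, μ i = ((Finset.range σ).filter (fun j => ((i : ℕ) : ℕ∞) ≤
      Module.length (PowerSeries k) (↥(W j) ⧸ (W (j + 1)).comap (W j).subtype))).card := by
    intro i
    have h1 := congrArg (fun s => Multiset.countP (fun a => i ≤ a) s) hdims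
    simp only [Multiset.countP_map] at h1
    have h2 : μ i = ((Finset.Icc 1 σ).filter (fun l => i ≤ Module.finrank k
        (RestrictScalars k (PowerSeries k)
        (↥(W (l - 1)) ⧸ (W l).comap (W (l - 1)).subtype)))).card := by
      rw [hμ]
      exact h1
    rw [h2]
    symm
    refine Finset.card_bij (fun j _ => j + 1) ?_ ?_ ?_
    · intro j hj
      rw [Finset.mem_filter, Finset.mem_range] at hj
      rw [Finset.mem_filter, Finset.mem_Icc]
      refine ⟨⟨by omega, by omega⟩, ?_⟩
      have h3 := hj.2
      rw [hlen j hj.1] at h3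
      exact_mod_cast h3
    · intro a _ b _ h
      omega
    · intro l hl
      rw [Finset.mem_filter, Finset.mem_Icc] at hl
      obtain ⟨j, rfl⟩ : ∃ j, l = j + 1 := ⟨l - 1, by omega⟩
      refine ⟨j, ?_, rfl⟩
      rw [Finset.mem_filter, Finset.mem_range]
      refine ⟨by omega, ?_⟩
      rw [hlen j (by omega)]
      exact_mod_cast hl.2
  have hprod : ∏ i ∈ Finset.Icc 1 (n 1), f i = ∏ i ∈ Finset.range (n 1), f (i + 1) := by
    rw [Finset.range_eq_Ico, Finset.prod_Ico_add' f 0 (n 1) 1]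
    rfl
  have hmain := PLD.main_induction (PowerSeries.X : PowerSeries k) hX σ (n 1) W θ hW0 hWσ'
    (fun i hi => (hchain i hi).le)
    (fun i hi x hx => hθ i hi (Submodule.mem_map_of_mem hx))
    (fun i => f (i + 1)) (fun i => w (i + 1)) (fun i => (f (i + 1)).natDegree)
    (fun i hi => (hw (i + 1) (by omega) (by omega)).1)
    (fun i hi => (hw (i + 1) (by omega) (by omega)).2.2)
    (fun i hi j hj hij => by
      apply PLD.unit_of_notMem _ hX
      rw [mul_sub, ← (hw (i + 1) (by omega) (by omega)).2.1,
        ← (hw (j + 1) (by omega) (by omega)).2.1]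
      exact hconst _ _ (by omega) (by omega) (by omega) (by omega) (by omega))
    (fun i hi => hdpos _ (by omega) (by omega))
    (fun i hi => by
      rw [hdeg _ (by omega) (by omega)]
      exact hcount (i + 1))
    (fun i hi => hker _ (Finset.mem_Icc.2 ⟨by omega, by omega⟩))
    (by rw [← hprod, ← hchar, LinearMap.aeval_self_charpoly])
  refine PLD.assemble (PowerSeries.X : PowerSeries k) hX θ
    (fun i : {x // x ∈ Finset.Icc 1 (n 1)} => f ↑i) ?_ ?_ ?_ ?_ ?_ ?_
  · rintro ⟨i, hi⟩
    rw [Finset.mem_Icc] at hi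
    exact hmonic i hi.1 hi.2
  · rintro ⟨i, hi⟩
    rw [Finset.mem_Icc] at hi
    exact hdpos i hi.1 hi.2
  · rintro ⟨i, hi⟩
    rw [Finset.mem_Icc] at hi
    exact ⟨w i, (hw i hi.1 hi.2).1, (hw i hi.1 hi.2).2.2⟩
  · rintro ⟨i, hi⟩
    exact hker i hi
  · rw [← LinearMap.charpoly_natDegree θ, hchar, Polynomial.natDegree_prod_of_monic]
    · exact Finset.sum_coe_sort (Finset.Icc 1 (n 1)) (fun i => (f i).natDegree)
    · intro i hi
      rw [Finset.mem_Icc] at hi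
      exact hmonic i hi.1 hi.2
  · intro v
    obtain ⟨x, hx1, hx2⟩ := hmain v
    refine ⟨fun i => x ((i : ℕ) - 1), ?_, ?_⟩
    · rintro ⟨i, hi⟩
      rw [Finset.mem_Icc] at hi
      have := hx1 (i - 1) (by omega)
      rwa [Nat.sub_add_cancel hi.1] at this
    · rw [hx2, Finset.sum_coe_sort (Finset.Icc 1 (n 1)) (fun i => x (i - 1)),
        Finset.range_eq_Ico]
      have := Finset.sum_Ico_add' (fun i => x (i - 1)) 0 (n 1) 1
      simp only [Nat.add_sub_cancel] at this
      rw [this]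
      rfl
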